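/- arXiv:2404.19228 — 8 statements merged into one kernel-verified Lean document; each statement's English description precedes it below -/
import Mathlib

section
/- Let 𝒳 and 𝒴 be nonempty finite types and let p be a joint pmf on 𝒳 × 𝒴 with p(x,y) > 0 for all (x,y). Then for every function g : 𝒳 × 𝒴 → ℝ, −L_NCE(g) ≤ I(p); that is, the mutual information of p is an upper bound of the negated symmetric InfoNCE loss. -/
open Finset

/-- `q` is a probability mass function on the finite type `S`. -/
def IsPmf {S : Type*} [Fintype S] (q : S → ℝ) : Prop :=
  (∀ s, 0 ≤ q s) ∧ ∑ s, q s = 1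

/-- Marginal of the joint pmf `p` on the first coordinate: `p_X(x) = ∑_y p(x,y)`. -/
noncomputable def margX {𝒳 𝒴 : Type*} [Fintype 𝒴] (p : 𝒳 × 𝒴 → ℝ) (x : 𝒳) : ℝ :=
  ∑ y, p (x, y)

/-- Marginal of the joint pmf `p` on the second coordinate: `p_Y(y) = ∑_x p(x,y)`. -/
noncomputable def margY {𝒳 𝒴 : Type*} [Fintype 𝒳] (p : 𝒳 × 𝒴 → ℝ) (y : 𝒴) : ℝ :=
  ∑ x, p (x, y)

/-- The (population) symmetric InfoNCE loss of the similarity `g` under the joint pmf `p`. -/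
noncomputable def LNCE {𝒳 𝒴 : Type*} [Fintype 𝒳] [Fintype 𝒴]
    (p : 𝒳 × 𝒴 → ℝ) (g : 𝒳 × 𝒴 → ℝ) : ℝ :=
  -(1 / 2) * ∑ x, ∑ y, p (x, y) *
      Real.log (Real.exp (g (x, y)) / ∑ x', margX p x' * Real.exp (g (x', y)))
  - (1 / 2) * ∑ x, ∑ y, p (x, y) *
      Real.log (Real.exp (g (x, y)) / ∑ y', margY p y' * Real.exp (g (x, y')))

/-- Mutual information `I(p) = ∑_{x,y} p(x,y) ln( p(x,y) / (p_X(x) p_Y(y)) )` of a joint pmf. -/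
noncomputable def mutualInfo {𝒳 𝒴 : Type*} [Fintype 𝒳] [Fintype 𝒴]
    (p : 𝒳 × 𝒴 → ℝ) : ℝ :=
  ∑ x, ∑ y, p (x, y) * Real.log (p (x, y) / (margX p x * margY p y))

/-- Gibbs-type comparison of expected logarithms under the weight `w`. -/
lemma sum_mul_log_le_sum_mul_log {ι : Type*} [Fintype ι] {w u v : ι → ℝ}
    (hw : ∀ i, 0 ≤ w i) (hu : ∀ i, 0 < u i) (hv : ∀ i, 0 < v i)
    (h : ∑ i, w i * (u i / v i) ≤ ∑ i, w i) :
    ∑ i, w i * Real.log (u i) ≤ ∑ i, w i * Real.log (v i) := by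
  have key : ∀ i, w i * Real.log (u i) ≤
      w i * Real.log (v i) + (w i * (u i / v i) - w i) := fun i ↦ by
    have h1 := Real.log_le_sub_one_of_pos (div_pos (hu i) (hv i))
    rw [Real.log_div (hu i).ne' (hv i).ne'] at h1
    nlinarith [mul_le_mul_of_nonneg_left h1 (hw i)]
  have h2 := Finset.sum_le_sum fun i (_ : i ∈ Finset.univ) ↦ key i
  rw [Finset.sum_add_distrib, Finset.sum_sub_distrib] at h2
  linarith

/-- **(Mutual information upper-bounds the negated symmetric InfoNCE.)** For a joint pmf
`p` with full support on the product of nonempty finite types, for every similarity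
`g : 𝒳 × 𝒴 → ℝ` we have `−L_NCE(g) ≤ I(p)`. -/
theorem neg_LNCE_le_mutualInfo
    {𝒳 𝒴 : Type*} [Fintype 𝒳] [Fintype 𝒴] [Nonempty 𝒳] [Nonempty 𝒴]
    (p : 𝒳 × 𝒴 → ℝ) (hp : IsPmf p) (hpos : ∀ x y, 0 < p (x, y)) :
    ∀ g : 𝒳 × 𝒴 → ℝ, -LNCE p g ≤ mutualInfo p := by
  intro g
  have hX : ∀ x, 0 < margX p x := fun x ↦ sum_pos (fun y _ ↦ hpos x y) univ_nonempty
  have hY : ∀ y, 0 < margY p y := fun y ↦ sum_pos (fun x _ ↦ hpos x y) univ_nonempty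
  have hZX : ∀ y, 0 < ∑ x', margX p x' * Real.exp (g (x', y)) := fun y ↦
    sum_pos (fun x _ ↦ mul_pos (hX x) (Real.exp_pos _)) univ_nonempty
  have hZY : ∀ x, 0 < ∑ y', margY p y' * Real.exp (g (x, y')) := fun x ↦
    sum_pos (fun y _ ↦ mul_pos (hY y) (Real.exp_pos _)) univ_nonempty
  have hA : ∑ x, ∑ y, p (x, y) *
      Real.log (Real.exp (g (x, y)) / ∑ x', margX p x' * Real.exp (g (x', y)))
      ≤ mutualInfo p := by
    have := sum_mul_log_le_sum_mul_log (w := p)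
      (u := fun z ↦ Real.exp (g z) / ∑ x', margX p x' * Real.exp (g (x', z.2)))
      (v := fun z ↦ p z / (margX p z.1 * margY p z.2)) hp.1
      (fun z ↦ div_pos (Real.exp_pos _) (hZX z.2))
      (fun z ↦ div_pos (hpos z.1 z.2) (mul_pos (hX _) (hY _))) ?_
    · simpa only [Fintype.sum_prod_type, mutualInfo] using this
    · simp only [Fintype.sum_prod_type_right]
      refine sum_le_sum fun y _ ↦ le_of_eq ?_
      calc _ = ∑ x, margX p x * Real.exp (g (x, y)) *
            (margY p y / ∑ x', margX p x' * Real.exp (g (x', y))) :=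
            sum_congr rfl fun x _ ↦ by
              have := (hpos x y).ne'
              have := (hZX y).ne'
              field_simp
        _ = margY p y := by rw [← sum_mul, mul_div_cancel₀ _ (hZX y).ne']
  have hB : ∑ x, ∑ y, p (x, y) *
      Real.log (Real.exp (g (x, y)) / ∑ y', margY p y' * Real.exp (g (x, y')))
      ≤ mutualInfo p := by
    have := sum_mul_log_le_sum_mul_log (w := p)
      (u := fun z ↦ Real.exp (g z) / ∑ y', margY p y' * Real.exp (g (z.1, y')))
      (v := fun z ↦ p z / (margX p z.1 * margY p z.2)) hp.1
      (fun z ↦ div_pos (Real.exp_pos _) (hZY z.1))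
      (fun z ↦ div_pos (hpos z.1 z.2) (mul_pos (hX _) (hY _))) ?_
    · simpa only [Fintype.sum_prod_type, mutualInfo] using this
    · simp only [Fintype.sum_prod_type]
      refine sum_le_sum fun x _ ↦ le_of_eq ?_
      calc _ = ∑ y, margY p y * Real.exp (g (x, y)) *
            (margX p x / ∑ y', margY p y' * Real.exp (g (x, y'))) :=
            sum_congr rfl fun y _ ↦ by
              have := (hpos x y).ne'
              have := (hZY x).ne'
              field_simp
        _ = margX p x := by rw [← sum_mul, mul_div_cancel₀ _ (hZY x).ne']
  unfold LNCE
  linarith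
end

section
/- Let 𝒳 and 𝒴 be nonempty finite types, let p be a joint pmf on 𝒳 × 𝒴 with p(x,y) > 0 for all (x,y), and let Γ ∈ ℝ. If g : 𝒳 × 𝒴 → ℝ satisfies g(x,y) = ln( p(x,y)/(p_X(x) p_Y(y)) ) + Γ for all (x,y), i.e., g equals the pointwise mutual information up to an additive constant, then L_NCE(g) = −I(p), so g attains the optimal (minimal) value of the symmetric InfoNCE loss. -/
open Finset

theorem margX_pos {𝒳 𝒴 : Type*} [Fintype 𝒴] [Nonempty 𝒴] {p : 𝒳 × 𝒴 → ℝ}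
    (hpos : ∀ x y, 0 < p (x, y)) (x : 𝒳) : 0 < margX p x :=
  Finset.sum_pos (fun y _ => hpos x y) Finset.univ_nonempty

theorem margY_pos {𝒳 𝒴 : Type*} [Fintype 𝒳] [Nonempty 𝒳] {p : 𝒳 × 𝒴 → ℝ}
    (hpos : ∀ x y, 0 < p (x, y)) (y : 𝒴) : 0 < margY p y :=
  Finset.sum_pos (fun x _ => hpos x y) Finset.univ_nonempty

/-- **(Pointwise mutual information attains the optimum of symmetric InfoNCE.)** For a
joint pmf `p` with full support on the product of nonempty finite types and `Γ : ℝ`, if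
`g(x,y) = ln( p(x,y)/(p_X(x) p_Y(y)) ) + Γ` for all `(x,y)` — i.e. `g` equals the
pointwise mutual information up to an additive constant — then `L_NCE(g) = −I(p)`. -/
theorem LNCE_eq_neg_mutualInfo_of_pmi
    {𝒳 𝒴 : Type*} [Fintype 𝒳] [Fintype 𝒴] [Nonempty 𝒳] [Nonempty 𝒴]
    (p : 𝒳 × 𝒴 → ℝ) (hp : IsPmf p) (hpos : ∀ x y, 0 < p (x, y)) (Γ : ℝ)
    (g : 𝒳 × 𝒴 → ℝ)
    (hg : ∀ x y, g (x, y) = Real.log (p (x, y) / (margX p x * margY p y)) + Γ) :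
    LNCE p g = -mutualInfo p := by
  have hX := margX_pos hpos
  have hY := margY_pos hpos
  have hexp (x : 𝒳) (y : 𝒴) : Real.exp (g (x, y)) =
      p (x, y) / (margX p x * margY p y) * Real.exp Γ := by
    rw [hg, Real.exp_add, Real.exp_log (div_pos (hpos x y) (mul_pos (hX x) (hY y)))]
  have hsumX (y : 𝒴) : ∑ x', margX p x' * Real.exp (g (x', y)) = Real.exp Γ := by
    calc ∑ x', margX p x' * Real.exp (g (x', y))
        = ∑ x', p (x', y) * (Real.exp Γ / margY p y) := by
          refine Finset.sum_congr rfl fun x' _ => ?_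
          have := (hX x').ne'
          rw [hexp]
          field_simp
      _ = margY p y * (Real.exp Γ / margY p y) := by rw [← Finset.sum_mul, margY]
      _ = Real.exp Γ := mul_div_cancel₀ _ (hY y).ne'
  have hsumY (x : 𝒳) : ∑ y', margY p y' * Real.exp (g (x, y')) = Real.exp Γ := by
    calc ∑ y', margY p y' * Real.exp (g (x, y'))
        = ∑ y', p (x, y') * (Real.exp Γ / margX p x) := by
          refine Finset.sum_congr rfl fun y' _ => ?_
          have := (hY y').ne'
          rw [hexp]
          field_simp
      _ = margX p x * (Real.exp Γ / margX p x) := by rw [← Finset.sum_mul, margX]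
      _ = Real.exp Γ := mul_div_cancel₀ _ (hX x).ne'
  simp only [LNCE, mutualInfo, hsumX, hsumY, ← Real.exp_sub, Real.log_exp]
  simp only [hg, add_sub_cancel_right]
  ring
end

section
/- Let 𝒳 and 𝒴 be nonempty finite types and p a joint pmf on 𝒳 × 𝒴. Fix x ∈ 𝒳 with p_X(x) > 0 and a nonempty subset 𝒴_c ⊆ 𝒴 such that p_Y(y) > 0 and p(x,y) > 0 for every y ∈ 𝒴_c. Then ∑_{y∈𝒴_c} ( p_Y(y)/P_Y(𝒴_c) ) · ln( p(x,y)/(p_X(x) p_Y(y)) ) + ln P_Y(𝒴_c) = ln P_Y(𝒴_c|x) − KL( p_Y(·|𝒴_c) ‖ p_Y(·|x,𝒴_c) ). -/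
open Finset

/-- Kullback–Leibler divergence `KL(q‖r) = ∑_{s : q s > 0} q s · ln (q s / r s)`. -/
noncomputable def KLdiv {S : Type*} [Fintype S] (q r : S → ℝ) : ℝ :=
  ∑ s ∈ Finset.univ.filter (fun s => 0 < q s), q s * Real.log (q s / r s)

/-- **(Expected pointwise mutual information over a class set.)** For a joint pmf `p`, a
point `x` with `p_X(x) > 0`, and a nonempty subset `𝒴_c ⊆ 𝒴` with `p_Y(y) > 0` and
`p(x,y) > 0` on `𝒴_c`:
`∑_{y∈𝒴_c} (p_Y(y)/P_Y(𝒴_c)) ln( p(x,y)/(p_X(x)p_Y(y)) ) + ln P_Y(𝒴_c)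
  = ln P_Y(𝒴_c|x) − KL( p_Y(·|𝒴_c) ‖ p_Y(·|x,𝒴_c) )`. -/
theorem expected_pmi_eq_log_cond_sub_KL
    {𝒳 𝒴 : Type*} [Fintype 𝒳] [Fintype 𝒴] [Nonempty 𝒳] [Nonempty 𝒴] [DecidableEq 𝒴]
    (p : 𝒳 × 𝒴 → ℝ) (hp : IsPmf p)
    (x : 𝒳) (hx : 0 < margX p x)
    (Yc : Finset 𝒴) (hYc : Yc.Nonempty)
    (hpos : ∀ y ∈ Yc, 0 < margY p y ∧ 0 < p (x, y)) :
    ∑ y ∈ Yc, (margY p y / ∑ y' ∈ Yc, margY p y') *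
        Real.log (p (x, y) / (margX p x * margY p y))
      + Real.log (∑ y' ∈ Yc, margY p y')
    = Real.log (∑ y' ∈ Yc, p (x, y') / margX p x)
      - KLdiv
          (fun y => if y ∈ Yc then margY p y / ∑ y' ∈ Yc, margY p y' else 0)
          (fun y => if y ∈ Yc then
              (p (x, y) / margX p x) / ∑ y' ∈ Yc, p (x, y') / margX p x
            else 0) := by
  have hP : 0 < ∑ y ∈ Yc, margY p y := Finset.sum_pos (fun y hy => (hpos y hy).1) hYc
  have hQ : 0 < ∑ y ∈ Yc, p (x, y) / margX p x :=
    Finset.sum_pos (fun y hy => div_pos (hpos y hy).2 hx) hYc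
  set P := ∑ y ∈ Yc, margY p y with hPdef
  set Q := ∑ y ∈ Yc, p (x, y) / margX p x
  have hfilter : Finset.univ.filter
      (fun y => 0 < if y ∈ Yc then margY p y / P else 0) = Yc := by
    ext y
    by_cases hy : y ∈ Yc
    · simp [hy, div_pos (hpos y hy).1 hP]
    · simp [hy]
  have hKL : KLdiv (fun y => if y ∈ Yc then margY p y / P else 0)
      (fun y => if y ∈ Yc then p (x, y) / margX p x / Q else 0)
      = ∑ y ∈ Yc, margY p y / P *
          Real.log (margY p y / P / (p (x, y) / margX p x / Q)) := by
    unfold KLdiv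
    rw [hfilter]
    exact Finset.sum_congr rfl fun y hy => by simp only [if_pos hy]
  have hterm : ∀ y ∈ Yc,
      margY p y / P * Real.log (p (x, y) / (margX p x * margY p y))
        = margY p y / P * (Real.log Q - Real.log P)
          - margY p y / P * Real.log (margY p y / P / (p (x, y) / margX p x / Q)) := by
    intro y hy
    obtain ⟨hy₁, hy₂⟩ := hpos y hy
    rw [Real.log_div hy₂.ne' (by positivity), Real.log_mul hx.ne' hy₁.ne',
      Real.log_div (by positivity) (by positivity), Real.log_div hy₁.ne' hP.ne',
      Real.log_div (by positivity) hQ.ne', Real.log_div hy₂.ne' hx.ne']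
    ring
  have hsum : ∑ y ∈ Yc, margY p y / P = 1 := by
    rw [← Finset.sum_div, ← hPdef, div_self hP.ne']
  rw [hKL, Finset.sum_congr rfl hterm, Finset.sum_sub_distrib, ← Finset.sum_mul, hsum]
  ring
end

section
/- Let 𝒳, 𝒴 be nonempty finite types, K ≥ 1, p a joint pmf on 𝒳 × 𝒴, and P_C(·|x) a pmf on {1,…,K} for each x, with P_C(c|x) > 0 for every c and every x with p_X(x) > 0. Let 𝒴_1,…,𝒴_K ⊆ 𝒴 be pairwise disjoint nonempty subsets with p_Y(y) > 0 for every y ∈ ⋃_i 𝒴_i, and assume p(x,y) > 0 whenever p_X(x) > 0 and y ∈ ⋃_i 𝒴_i. Let f_X : 𝒳 → ℝ^d, f_Y : 𝒴 → ℝ^d, τ > 0, and Γ ∈ ℝ satisfy (1/τ)⟪f_X(x), f_Y(y)⟫ = ln( p(x,y)/(p_X(x) p_Y(y)) ) + Γ for every x with p_X(x) > 0 and every y ∈ ⋃_i 𝒴_i; write g*(x,y) = (1/τ)⟪f_X(x), f_Y(y)⟫. Let h̄^{g*} be the induced classifier and h*(x)_c = ln P_C(c|x). Then L_sup(h̄^{g*})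 − L_sup(h*) ≤ ∑_{x : p_X(x)>0} p_X(x) · KL( P_C(·|x) ‖ P_C(·|x;(𝒴_i)) ) + ∑_{x : p_X(x)>0} ∑_{c=1}^K p_X(x) P_C(c|x) · KL( p_Y(·|𝒴_c) ‖ p_Y(·|x,𝒴_c) ). -/
open Finset

/-- Log-softmax of `z : ℝ^K` at index `c`. -/
noncomputable def logSoftmax {K : ℕ} (z : Fin K → ℝ) (c : Fin K) : ℝ :=
  Real.log (Real.exp (z c) / ∑ i, Real.exp (z i))

/-- Supervised softmax cross-entropy loss
`L_sup(h) = −∑_x ∑_c p_X(x) P_C(c|x) σ_c(h(x))`. -/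
noncomputable def Lsup {𝒳 : Type*} [Fintype 𝒳] {K : ℕ}
    (pX : 𝒳 → ℝ) (PC : 𝒳 → Fin K → ℝ) (h : 𝒳 → Fin K → ℝ) : ℝ :=
  -∑ x, ∑ c, pX x * PC x c * logSoftmax (h x) c

/-- The classifier `h̄^g` induced by a similarity `g : 𝒳 → 𝒴 → ℝ` and disjoint class
sets `Y c ⊆ 𝒴`: `h̄^g(x)_c = ∑_{y∈Y c} p_Y(y|Y c) g(x,y) + ln P_Y(Y c)`. -/
noncomputable def inducedClassifier {𝒳 𝒴 : Type*} [Fintype 𝒳] [Fintype 𝒴] {K : ℕ}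
    (p : 𝒳 × 𝒴 → ℝ) (Y : Fin K → Finset 𝒴) (g : 𝒳 → 𝒴 → ℝ) (x : 𝒳) (c : Fin K) : ℝ :=
  ∑ y ∈ Y c, (margY p y / ∑ y' ∈ Y c, margY p y') * g x y
    + Real.log (∑ y' ∈ Y c, margY p y')

theorem KLdiv_eq_sum_of_pos {S : Type*} [Fintype S] {q : S → ℝ} (hq : ∀ s, 0 < q s)
    (r : S → ℝ) : KLdiv q r = ∑ s, q s * Real.log (q s / r s) := by
  rw [KLdiv, Finset.filter_true_of_mem fun s _ => hq s]

/-- Gibbs' inequality. -/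
theorem KLdiv_nonneg {S : Type*} [Fintype S] {q r : S → ℝ} (hq : IsPmf q) (hr : IsPmf r)
    (hqr : ∀ s, 0 < q s → 0 < r s) : 0 ≤ KLdiv q r := by
  have hsum : ∑ s ∈ univ.filter (fun s => 0 < q s), q s = 1 := by
    rw [← hq.2]
    refine sum_subset (filter_subset _ _) fun s _ hs => ?_
    exact le_antisymm (not_lt.1 fun h => hs (by simpa using h)) (hq.1 s)
  have hle : ∑ s ∈ univ.filter (fun s => 0 < q s), r s ≤ 1 := by
    rw [← hr.2]
    exact sum_le_sum_of_subset_of_nonneg (filter_subset _ _) fun s _ _ => hr.1 s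
  have hterm : ∑ s ∈ univ.filter (fun s => 0 < q s), (q s - r s) ≤ KLdiv q r := by
    refine sum_le_sum fun s hs => ?_
    have hqs : 0 < q s := (mem_filter.1 hs).2
    have hrs := hqr s hqs
    calc q s - r s = q s * (1 - (q s / r s)⁻¹) := by field_simp
      _ ≤ q s * Real.log (q s / r s) :=
        mul_le_mul_of_nonneg_left (Real.one_sub_inv_le_log_of_pos (div_pos hqs hrs)) hqs.le
  rw [sum_sub_distrib, hsum] at hterm
  linarith

theorem isPmf_normalized {S : Type*} [Fintype S] [DecidableEq S] {t : Finset S}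
    (ht : t.Nonempty) {a : S → ℝ} (ha : ∀ s ∈ t, 0 < a s) :
    IsPmf (fun s => if s ∈ t then a s / ∑ s' ∈ t, a s' else 0) := by
  have hA : 0 < ∑ s ∈ t, a s := sum_pos ha ht
  refine ⟨fun s => ?_, ?_⟩
  · dsimp only
    split_ifs with h
    · exact (div_pos (ha s h) hA).le
    · exact le_rfl
  · rw [sum_ite_mem, univ_inter, ← sum_div, div_self hA.ne']

theorem KLdiv_normalized_nonneg {S : Type*} [Fintype S] [DecidableEq S] {t : Finset S}
    (ht : t.Nonempty) {a b : S → ℝ} (ha : ∀ s ∈ t, 0 < a s) (hb : ∀ s ∈ t, 0 < b s) :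
    0 ≤ KLdiv (fun s => if s ∈ t then a s / ∑ s' ∈ t, a s' else 0)
      (fun s => if s ∈ t then b s / ∑ s' ∈ t, b s' else 0) := by
  refine KLdiv_nonneg (isPmf_normalized ht ha) (isPmf_normalized ht hb) fun s hs => ?_
  by_cases h : s ∈ t
  · simpa only [h, if_true] using div_pos (hb s h) (sum_pos hb ht)
  · simp [h] at hs

/-- The mean of `ln (b / a)` under the normalization of `a` on `t`, in terms of the divergence
between the normalizations of `a` and `b`. -/
theorem sum_normalized_mul_log_div {S : Type*} [Fintype S] [DecidableEq S] {t : Finset S}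
    (ht : t.Nonempty) {a b : S → ℝ} (ha : ∀ s ∈ t, 0 < a s) (hb : ∀ s ∈ t, 0 < b s) :
    ∑ s ∈ t, a s / (∑ s' ∈ t, a s') * Real.log (b s / a s) =
      Real.log (∑ s ∈ t, b s) - Real.log (∑ s ∈ t, a s)
        - KLdiv (fun s => if s ∈ t then a s / ∑ s' ∈ t, a s' else 0)
            (fun s => if s ∈ t then b s / ∑ s' ∈ t, b s' else 0) := by
  have hA : 0 < ∑ s ∈ t, a s := sum_pos ha ht
  have hB : 0 < ∑ s ∈ t, b s := sum_pos hb ht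
  set A := ∑ s ∈ t, a s
  set B := ∑ s ∈ t, b s
  have hfilter : univ.filter (fun s => 0 < if s ∈ t then a s / A else 0) = t := by
    ext s
    by_cases h : s ∈ t
    · simpa [h] using div_pos (ha s h) hA
    · simp [h]
  have hone : ∑ s ∈ t, a s / A = 1 := by rw [← sum_div, div_self hA.ne']
  have hconst : Real.log B - Real.log A = ∑ s ∈ t, a s / A * (Real.log B - Real.log A) := by
    rw [← sum_mul, hone, one_mul]
  rw [KLdiv, hfilter, hconst, ← sum_sub_distrib]
  refine sum_congr rfl fun s hs => ?_
  have has := ha s hs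
  have hbs := hb s hs
  simp only [hs, if_true]
  rw [Real.log_div (div_pos has hA).ne' (div_pos hbs hB).ne', Real.log_div has.ne' hA.ne',
    Real.log_div hbs.ne' hB.ne', Real.log_div hbs.ne' has.ne']
  ring

theorem logSoftmax_log {K : ℕ} {q : Fin K → ℝ} (hq : IsPmf q) (hpos : ∀ c, 0 < q c)
    (c : Fin K) : logSoftmax (fun i => Real.log (q i)) c = Real.log (q c) := by
  simp only [logSoftmax, Real.exp_log (hpos _), hq.2, div_one]

/-- Lowering the logits `ln (B c) + Γ` by nonnegative amounts `k c` decreases the log-softmax at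
`c` by at most `k c`. -/
theorem log_div_sum_sub_le_logSoftmax {K : ℕ} {z B k : Fin K → ℝ} {Γ : ℝ}
    (hB : ∀ c, 0 < B c) (hk : ∀ c, 0 ≤ k c) (hz : ∀ c, z c = Real.log (B c) - k c + Γ)
    (c : Fin K) : Real.log (B c / ∑ i, B i) - k c ≤ logSoftmax z c := by
  have hne : (univ : Finset (Fin K)).Nonempty := ⟨c, mem_univ c⟩
  have hS : 0 < ∑ i, B i := sum_pos (fun i _ => hB i) hne
  have hE : 0 < ∑ i, Real.exp (z i) := sum_pos (fun i _ => Real.exp_pos _) hne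
  have hle : ∑ i, Real.exp (z i) ≤ (∑ i, B i) * Real.exp Γ := by
    rw [sum_mul]
    refine sum_le_sum fun i _ => ?_
    calc Real.exp (z i) ≤ Real.exp (Real.log (B i) + Γ) :=
          Real.exp_le_exp.2 (by linarith [hz i, hk i])
      _ = B i * Real.exp Γ := by rw [Real.exp_add, Real.exp_log (hB i)]
  have hlog := Real.log_le_log hE hle
  rw [Real.log_mul hS.ne' (Real.exp_pos _).ne', Real.log_exp] at hlog
  rw [logSoftmax, Real.log_div (Real.exp_pos _).ne' hE.ne', Real.log_exp,
    Real.log_div (hB c).ne' hS.ne']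
  linarith [hz c]

theorem Lsup_sub_Lsup {𝒳 : Type*} [Fintype 𝒳] {K : ℕ} {pX : 𝒳 → ℝ} (hpX : ∀ x, 0 ≤ pX x)
    (PC h h' : 𝒳 → Fin K → ℝ) :
    Lsup pX PC h - Lsup pX PC h' = ∑ x ∈ univ.filter (fun x => 0 < pX x),
      pX x * ∑ c, PC x c * (logSoftmax (h' x) c - logSoftmax (h x) c) := by
  have hfull : Lsup pX PC h - Lsup pX PC h' =
      ∑ x, pX x * ∑ c, PC x c * (logSoftmax (h' x) c - logSoftmax (h x) c) := by
    simp only [Lsup, neg_sub_neg, ← sum_sub_distrib, mul_sum]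
    exact sum_congr rfl fun x _ => sum_congr rfl fun c _ => by ring
  rw [hfull]
  refine (sum_subset (filter_subset _ _) fun x _ hx => ?_).symm
  rw [le_antisymm (not_lt.1 fun h => hx (by simpa using h)) (hpX x), zero_mul]

/-- When the similarity is the pointwise mutual information up to the constant `Γ`, each logit of
the induced classifier is `ln P_Y(Y c|x) + Γ` minus a divergence. -/
theorem inducedClassifier_eq_of_pmi {𝒳 𝒴 : Type*} [Fintype 𝒳] [Fintype 𝒴] [DecidableEq 𝒴]
    {K : ℕ} {p : 𝒳 × 𝒴 → ℝ} {Y : Fin K → Finset 𝒴} {g : 𝒳 → 𝒴 → ℝ} {Γ : ℝ} {x : 𝒳} {c : Fin K}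
    (hx : 0 < margX p x) (hne : (Y c).Nonempty) (hpY : ∀ y ∈ Y c, 0 < margY p y)
    (hp : ∀ y ∈ Y c, 0 < p (x, y))
    (hg : ∀ y ∈ Y c, g x y = Real.log (p (x, y) / (margX p x * margY p y)) + Γ) :
    inducedClassifier p Y g x c = Real.log (∑ y ∈ Y c, p (x, y) / margX p x)
      - KLdiv (fun y => if y ∈ Y c then margY p y / ∑ y' ∈ Y c, margY p y' else 0)
          (fun y => if y ∈ Y c then
            (p (x, y) / margX p x) / ∑ y' ∈ Y c, p (x, y') / margX p x else 0) + Γ := by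
  have hone : ∑ y ∈ Y c, margY p y / (∑ y' ∈ Y c, margY p y') = 1 := by
    rw [← sum_div, div_self (sum_pos hpY hne).ne']
  have hmean := sum_normalized_mul_log_div hne hpY fun y hy => div_pos (hp y hy) hx
  have hsplit : ∑ y ∈ Y c, margY p y / (∑ y' ∈ Y c, margY p y') * g x y =
      ∑ y ∈ Y c, margY p y / (∑ y' ∈ Y c, margY p y') *
        Real.log (p (x, y) / margX p x / margY p y) + Γ := by
    rw [← one_mul Γ, ← hone, sum_mul, ← sum_add_distrib]
    exact sum_congr rfl fun y hy => by rw [hg y hy, div_div, mul_add]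
  rw [inducedClassifier, hsplit, hmean]
  ring

/-- **(Theorem 1: excess risk bound when the optimal similarity is attained.)** Suppose the
scaled inner-product similarity `g*(x,y) = (1/τ)⟪f_X(x), f_Y(y)⟫` equals the pointwise
mutual information up to an additive constant `Γ` on the support of `p_X` and the union
of the disjoint class sets `Y i`. Then the excess risk of the induced linear classifier
`h̄^{g*}` over the optimal classifier `h*(x)_c = ln P_C(c|x)` is bounded by the sum of
the two expected KL-divergence terms. -/
theorem excess_risk_bound_of_optimal_similarity
    {𝒳 𝒴 : Type*} [Fintype 𝒳] [Fintype 𝒴] [Nonempty 𝒳] [Nonempty 𝒴] [DecidableEq 𝒴]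
    {K d : ℕ} (hK : 1 ≤ K)
    (p : 𝒳 × 𝒴 → ℝ) (hp : IsPmf p)
    (PC : 𝒳 → Fin K → ℝ) (hPC : ∀ x, IsPmf (PC x))
    (hPCpos : ∀ x, 0 < margX p x → ∀ c, 0 < PC x c)
    (Y : Fin K → Finset 𝒴)
    (hdisj : ∀ i j, i ≠ j → Disjoint (Y i) (Y j))
    (hYne : ∀ i, (Y i).Nonempty)
    (hpYpos : ∀ i, ∀ y ∈ Y i, 0 < margY p y)
    (hpxy : ∀ x, 0 < margX p x → ∀ i, ∀ y ∈ Y i, 0 < p (x, y))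
    (fX : 𝒳 → Fin d → ℝ) (fY : 𝒴 → Fin d → ℝ) (τ : ℝ) (hτ : 0 < τ) (Γ : ℝ)
    (hopt : ∀ x, 0 < margX p x → ∀ i, ∀ y ∈ Y i,
      (1 / τ) * ∑ j, fX x j * fY y j
        = Real.log (p (x, y) / (margX p x * margY p y)) + Γ) :
    Lsup (margX p) PC
        (inducedClassifier p Y (fun x y => (1 / τ) * ∑ j, fX x j * fY y j))
      - Lsup (margX p) PC (fun x c => Real.log (PC x c))
    ≤ ∑ x ∈ Finset.univ.filter (fun x => 0 < margX p x),
        margX p x * KLdiv (PC x)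
          (fun c => (∑ y ∈ Y c, p (x, y) / margX p x)
            / ∑ i, ∑ y ∈ Y i, p (x, y) / margX p x)
      + ∑ x ∈ Finset.univ.filter (fun x => 0 < margX p x), ∑ c,
          margX p x * PC x c * KLdiv
            (fun y => if y ∈ Y c then margY p y / ∑ y' ∈ Y c, margY p y' else 0)
            (fun y => if y ∈ Y c then
                (p (x, y) / margX p x) / ∑ y' ∈ Y c, p (x, y') / margX p x
              else 0) := by
  have hmargX : ∀ x, 0 ≤ margX p x := fun x => sum_nonneg fun y _ => hp.1 (x, y)
  rw [Lsup_sub_Lsup hmargX, ← sum_add_distrib]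
  refine sum_le_sum fun x hx => ?_
  replace hx : 0 < margX p x := (mem_filter.1 hx).2
  have hb : ∀ c, ∀ y ∈ Y c, 0 < p (x, y) / margX p x :=
    fun c y hy => div_pos (hpxy x hx c y hy) hx
  have hB : ∀ c, 0 < ∑ y ∈ Y c, p (x, y) / margX p x := fun c => sum_pos (hb c) (hYne c)
  simp only [mul_assoc]
  rw [← mul_sum, ← mul_add, KLdiv_eq_sum_of_pos (hPCpos x hx), ← sum_add_distrib]
  refine mul_le_mul_of_nonneg_left (sum_le_sum fun c _ => ?_) hx.le
  have hS : 0 < ∑ i, ∑ y ∈ Y i, p (x, y) / margX p x := sum_pos (fun i _ => hB i) ⟨c, mem_univ c⟩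
  rw [← mul_add]
  refine mul_le_mul_of_nonneg_left ?_ (hPCpos x hx c).le
  rw [logSoftmax_log (hPC x) (hPCpos x hx),
    Real.log_div (hPCpos x hx c).ne' (div_pos (hB c) hS).ne']
  have hsoft := log_div_sum_sub_le_logSoftmax hB
    (fun i => KLdiv_normalized_nonneg (hYne i) (hpYpos i) (hb i))
    (fun i => inducedClassifier_eq_of_pmi
      (g := fun x y => (1 / τ) * ∑ j, fX x j * fY y j) hx (hYne i) (hpYpos i) (hpxy x hx i)
      (hopt x hx i)) c
  linarith
end

section
/- Let 𝒳, 𝒴 be nonempty finite types, K ≥ 1, p a joint pmf on 𝒳 × 𝒴, and P_C(·|x) a pmf on {1,…,K} for each x. Let 𝒴_1,…,𝒴_K ⊆ 𝒴 be pairwise disjoint nonempty subsets with p_Y(y) > 0 for every y ∈ ⋃_i 𝒴_i. Let g, g* : 𝒳 × 𝒴 → ℝ and Δ ≥ 0 satisfy |g(x,y) − g*(x,y)| ≤ Δ for every x with p_X(x) > 0 and every y with p_Y(y) > 0. Then the induced classifiers satisfy |L_sup(h̄^g) − L_sup(h̄^{g*})| ≤ 2Δ. -/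
open Finset

lemma logSoftmax_eq {K : ℕ} (z : Fin K → ℝ) (c : Fin K) :
    logSoftmax z c = z c - Real.log (∑ i, Real.exp (z i)) := by
  have hpos : 0 < ∑ i, Real.exp (z i) :=
    Finset.sum_pos (fun i _ => Real.exp_pos _) ⟨c, Finset.mem_univ c⟩
  rw [logSoftmax, Real.log_div (Real.exp_pos _).ne' hpos.ne', Real.log_exp]

lemma log_sum_exp_le_add {ι : Type*} [Fintype ι] [Nonempty ι] {z w : ι → ℝ} {Δ : ℝ}
    (h : ∀ i, z i ≤ w i + Δ) :
    Real.log (∑ i, Real.exp (z i)) ≤ Real.log (∑ i, Real.exp (w i)) + Δ := by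
  have hpos (v : ι → ℝ) : 0 < ∑ i, Real.exp (v i) :=
    Finset.sum_pos (fun i _ => Real.exp_pos _) Finset.univ_nonempty
  calc Real.log (∑ i, Real.exp (z i))
      ≤ Real.log ((∑ i, Real.exp (w i)) * Real.exp Δ) := by
        refine Real.log_le_log (hpos z) ?_
        rw [Finset.sum_mul]
        refine Finset.sum_le_sum fun i _ => ?_
        rw [← Real.exp_add]
        exact Real.exp_le_exp.mpr (h i)
    _ = Real.log (∑ i, Real.exp (w i)) + Δ := by
        rw [Real.log_mul (hpos w).ne' (Real.exp_pos Δ).ne', Real.log_exp]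

lemma abs_logSoftmax_sub_le {K : ℕ} {z w : Fin K → ℝ} {Δ : ℝ}
    (h : ∀ i, |z i - w i| ≤ Δ) (c : Fin K) :
    |logSoftmax z c - logSoftmax w c| ≤ 2 * Δ := by
  have : Nonempty (Fin K) := ⟨c⟩
  have hzw := log_sum_exp_le_add (z := z) (w := w) fun i => by
    linarith [(abs_le.mp (h i)).2]
  have hwz := log_sum_exp_le_add (z := w) (w := z) fun i => by
    linarith [(abs_le.mp (h i)).1]
  obtain ⟨hl, hu⟩ := abs_le.mp (h c)
  rw [logSoftmax_eq, logSoftmax_eq, abs_le]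
  constructor <;> linarith

lemma abs_sum_mul_sub_sum_mul_le {ι : Type*} {s : Finset ι} {w a b : ι → ℝ} {B : ℝ}
    (hw : ∀ i ∈ s, 0 ≤ w i) (hsum : ∑ i ∈ s, w i = 1)
    (h : ∀ i ∈ s, 0 < w i → |a i - b i| ≤ B) :
    |∑ i ∈ s, w i * a i - ∑ i ∈ s, w i * b i| ≤ B := by
  rw [← Finset.sum_sub_distrib]
  calc |∑ i ∈ s, (w i * a i - w i * b i)|
      ≤ ∑ i ∈ s, |w i * a i - w i * b i| := Finset.abs_sum_le_sum_abs _ _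
    _ ≤ ∑ i ∈ s, w i * B := by
        refine Finset.sum_le_sum fun i hi => ?_
        rw [← mul_sub, abs_mul, abs_of_nonneg (hw i hi)]
        rcases (hw i hi).eq_or_lt with h0 | h0
        · simp [← h0]
        · exact mul_le_mul_of_nonneg_left (h i hi h0) h0.le
    _ = B := by rw [← Finset.sum_mul, hsum, one_mul]

lemma abs_inducedClassifier_sub_le {𝒳 𝒴 : Type*} [Fintype 𝒳] [Fintype 𝒴] {K : ℕ}
    {p : 𝒳 × 𝒴 → ℝ} {Y : Fin K → Finset 𝒴} {c : Fin K} (hYne : (Y c).Nonempty)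
    (hpYpos : ∀ y ∈ Y c, 0 < margY p y) {g g' : 𝒳 → 𝒴 → ℝ} {Δ : ℝ} {x : 𝒳}
    (hgap : ∀ y ∈ Y c, |g x y - g' x y| ≤ Δ) :
    |inducedClassifier p Y g x c - inducedClassifier p Y g' x c| ≤ Δ := by
  have hpos : 0 < ∑ y ∈ Y c, margY p y := Finset.sum_pos hpYpos hYne
  rw [inducedClassifier, inducedClassifier, add_sub_add_right_eq_sub]
  refine abs_sum_mul_sub_sum_mul_le (fun y hy => (div_pos (hpYpos y hy) hpos).le) ?_
    fun y hy _ => hgap y hy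
  rw [← Finset.sum_div, div_self hpos.ne']

lemma IsPmf.margX {𝒳 𝒴 : Type*} [Fintype 𝒳] [Fintype 𝒴] {p : 𝒳 × 𝒴 → ℝ} (hp : IsPmf p) :
    IsPmf (margX p) :=
  ⟨fun x => Finset.sum_nonneg fun y _ => hp.1 (x, y), by
    simpa only [_root_.margX, Fintype.sum_prod_type] using hp.2⟩

lemma abs_Lsup_sub_le {𝒳 : Type*} [Fintype 𝒳] {K : ℕ} {pX : 𝒳 → ℝ} (hpX : IsPmf pX)
    {PC : 𝒳 → Fin K → ℝ} (hPC : ∀ x, IsPmf (PC x)) {h h' : 𝒳 → Fin K → ℝ} {Δ : ℝ}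
    (hgap : ∀ x, 0 < pX x → ∀ c, |h x c - h' x c| ≤ Δ) :
    |Lsup pX PC h - Lsup pX PC h'| ≤ 2 * Δ := by
  simp only [Lsup, mul_assoc, ← Finset.mul_sum]
  rw [neg_sub_neg, abs_sub_comm]
  exact abs_sum_mul_sub_sum_mul_le (fun x _ => hpX.1 x) hpX.2 fun x _ hx =>
    abs_sum_mul_sub_sum_mul_le (fun c _ => (hPC x).1 c) (hPC x).2 fun c _ _ =>
      abs_logSoftmax_sub_le (hgap x hx) c

/-- **(Lemma 2: stability of the supervised loss of induced classifiers.)** If two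
similarities `g` and `g*` differ by at most `Δ` on the supports of the marginals, then
the supervised losses of the induced classifiers `h̄^g` and `h̄^{g*}` differ by at most
`2Δ`. -/
theorem Lsup_inducedClassifier_stability
    {𝒳 𝒴 : Type*} [Fintype 𝒳] [Fintype 𝒴] [Nonempty 𝒳] [Nonempty 𝒴]
    {K : ℕ} (hK : 1 ≤ K)
    (p : 𝒳 × 𝒴 → ℝ) (hp : IsPmf p)
    (PC : 𝒳 → Fin K → ℝ) (hPC : ∀ x, IsPmf (PC x))
    (Y : Fin K → Finset 𝒴)
    (hdisj : ∀ i j, i ≠ j → Disjoint (Y i) (Y j))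
    (hYne : ∀ i, (Y i).Nonempty)
    (hpYpos : ∀ i, ∀ y ∈ Y i, 0 < margY p y)
    (g gstar : 𝒳 → 𝒴 → ℝ) (Δ : ℝ) (hΔ : 0 ≤ Δ)
    (hgap : ∀ x, 0 < margX p x → ∀ y, 0 < margY p y → |g x y - gstar x y| ≤ Δ) :
    |Lsup (margX p) PC (inducedClassifier p Y g)
        - Lsup (margX p) PC (inducedClassifier p Y gstar)| ≤ 2 * Δ := by
  exact abs_Lsup_sub_le hp.margX hPC fun x hx c =>
    abs_inducedClassifier_sub_le (hYne c) (hpYpos c) fun y hy =>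
      hgap x hx y (hpYpos c y hy)
end

section
/- Let d ∈ ℕ, let S_X and S_Y be nonempty compact subsets of ℝ^d, and let F : ℝ^d × ℝ^d → ℝ be L-Lipschitz on S_X × S_Y (with respect to the Euclidean product metric), for some L > 0. Let k : ℝ^d × ℝ^d → ℝ be a kernel with the property that for every continuous function φ : ℝ^d → ℝ and every δ > 0 there exist n ∈ ℕ, coefficients c_1,…,c_n ∈ ℝ, and points η_1,…,η_n ∈ ℝ^d such that sup_{x̃ ∈ S_X} |φ(x̃) − ∑_{j=1}^n c_j k(x̃, η_j)| < δ. Then for every ε > 0 there exist M ∈ ℕ and functions w : S_Y → (Fin M → ℝ) and v : S_Y → (Fin M → ℝ^d) such that for all x̃ ∈ S_X and ỹ ∈ S_Y, |∑_{j=1}^M w_j(ỹ) · k(x̃, v_j(ỹ)) − F(x̃, ỹ)| < ε; that is, F can be uniformly approximated by kernel similarities of weighted point sets with a number of points M that is uniform in ỹ. -/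
open Finset

/-- A weighted finite sum of sections of `k` can be written with any larger number of terms. -/
theorem exists_weighted_sum_eq_of_le {X Y : Type*} [Inhabited Y] (k : X → Y → ℝ) {n N : ℕ}
    (h : n ≤ N) (c : Fin n → ℝ) (η : Fin n → Y) :
    ∃ (c' : Fin N → ℝ) (η' : Fin N → Y),
      ∀ x, ∑ j, c' j * k x (η' j) = ∑ j, c j * k x (η j) := by
  obtain ⟨m, rfl⟩ := Nat.exists_eq_add_of_le h
  exact ⟨Fin.append c fun _ => 0, Fin.append η fun _ => default,
    fun x => by simp [Fin.sum_univ_add]⟩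

/-- **(Theorem 3: uniform approximation by kernel similarities of weighted point sets.)**
Let `S_X, S_Y ⊆ ℝ^d` be nonempty compact sets, `F` be `L`-Lipschitz on `S_X × S_Y` for the
Euclidean product metric, and `k` a kernel whose span of sections `x̃ ↦ k(x̃, η)` is
uniformly dense on `S_X` among continuous functions. Then for every `ε > 0` there are
`M : ℕ` and maps `w : S_Y → ℝ^M`, `v : S_Y → (ℝ^d)^M` with
`|∑ j w_j(ỹ) k(x̃, v_j(ỹ)) − F(x̃, ỹ)| < ε` for all `x̃ ∈ S_X`, `ỹ ∈ S_Y`. -/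
theorem uniform_approx_weighted_point_sets
    (d : ℕ)
    (SX SY : Set (EuclideanSpace ℝ (Fin d)))
    (hSXne : SX.Nonempty) (hSYne : SY.Nonempty)
    (hSXc : IsCompact SX) (hSYc : IsCompact SY)
    (F : EuclideanSpace ℝ (Fin d) → EuclideanSpace ℝ (Fin d) → ℝ)
    (L : ℝ) (hL : 0 < L)
    (hLip : ∀ x ∈ SX, ∀ x' ∈ SX, ∀ y ∈ SY, ∀ y' ∈ SY,
      |F x y - F x' y'| ≤ L * Real.sqrt (‖x - x'‖ ^ 2 + ‖y - y'‖ ^ 2))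
    (k : EuclideanSpace ℝ (Fin d) → EuclideanSpace ℝ (Fin d) → ℝ)
    (hk : ∀ φ : EuclideanSpace ℝ (Fin d) → ℝ, Continuous φ → ∀ δ > 0,
      ∃ (n : ℕ) (c : Fin n → ℝ) (η : Fin n → EuclideanSpace ℝ (Fin d)),
        ∀ x ∈ SX, |φ x - ∑ j, c j * k x (η j)| < δ) :
    ∀ ε > 0,
      ∃ (M : ℕ) (w : SY → Fin M → ℝ) (v : SY → Fin M → EuclideanSpace ℝ (Fin d)),
        ∀ x ∈ SX, ∀ y : SY,
          |(∑ j, w y j * k x (v y j)) - F x (y : EuclideanSpace ℝ (Fin d))| < ε := by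
  intro ε hε
  let P : EuclideanSpace ℝ (Fin d) → ℕ → Prop := fun y N =>
    ∃ (c : Fin N → ℝ) (η : Fin N → EuclideanSpace ℝ (Fin d)),
      ∀ x ∈ SX, |(∑ j, c j * k x (η j)) - F x y| < ε
  have hP_mono : ∀ {y n N}, n ≤ N → P y n → P y N := by
    rintro y n N hnN ⟨c, η, h⟩
    obtain ⟨c', η', h'⟩ := exists_weighted_sum_eq_of_le k hnN c η
    exact ⟨c', η', fun x hx => by rw [h']; exact h x hx⟩
  have h_unif : ∃ M, ∀ y ∈ SY, P y M := by
    refine hSYc.induction_on (p := fun s => ∃ M, ∀ y ∈ s, P y M) ⟨0, by simp⟩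
      (fun s t hst ⟨M, hM⟩ => ⟨M, fun y hy => hM y (hst hy)⟩) ?_ ?_
    · rintro s t ⟨M, hM⟩ ⟨N, hN⟩
      refine ⟨max M N, fun y hy => hy.elim ?_ ?_⟩
      · exact fun hy => hP_mono (le_max_left _ _) (hM y hy)
      · exact fun hy => hP_mono (le_max_right _ _) (hN y hy)
    · intro y hy
      have h_lip : LipschitzOnWith L.toNNReal (fun x => F x y) SX := by
        refine LipschitzOnWith.of_dist_le_mul fun x hx x' hx' => ?_
        have := hLip x hx x' hx' y hy y hy
        rw [sub_self, norm_zero, zero_pow two_ne_zero, add_zero,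
          Real.sqrt_sq (norm_nonneg _)] at this
        rwa [Real.dist_eq, dist_eq_norm, Real.coe_toNNReal _ hL.le]
      obtain ⟨φ, hφ, hφF⟩ := h_lip.extend_real
      obtain ⟨n, c, η, hn⟩ := hk φ hφ.continuous (ε / 2) (half_pos hε)
      refine ⟨SY ∩ Metric.ball y (ε / (2 * L)), inter_mem_nhdsWithin _
        (Metric.ball_mem_nhds _ (by positivity)), n, ?_⟩
      rintro z ⟨hz, hzy⟩
      refine ⟨c, η, fun x hx => ?_⟩
      have h_near := hLip x hx x hx y hy z hz
      rw [sub_self, norm_zero, zero_pow two_ne_zero, zero_add,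
        Real.sqrt_sq (norm_nonneg _)] at h_near
      rw [Metric.mem_ball', dist_eq_norm, lt_div_iff₀ (by positivity)] at hzy
      have h_approx := hn x hx
      rw [← hφF hx, abs_sub_comm] at h_approx
      calc |(∑ j, c j * k x (η j)) - F x z|
          ≤ |(∑ j, c j * k x (η j)) - F x y| + |F x y - F x z| := abs_sub_le _ _ _
        _ < ε := by linarith
  obtain ⟨M, hM⟩ := h_unif
  choose w v h using fun y : SY => hM y y.2
  exact ⟨M, w, v, fun x hx y => h y x hx⟩
end

section
/- Let A, B, C, D, 𝒳, 𝒴 be nonempty finite types with bijections e_X : A × C ≃ 𝒳 and e_Y : B × D ≃ 𝒴. Let q be a joint pmf on A × B and let r, s be pmfs on C and D respectively, and define the joint pmf p on 𝒳 × 𝒴 by p(e_X(a,c), e_Y(b,d)) = q(a,b) · r(c) · s(d). Then for all a, b, c, d with q(a,b) > 0, q_A(a) > 0, q_B(b) > 0, r(c) > 0, and s(d) > 0, the pointwise mutual information is preserved: p(x,y)/(p_X(x) p_Y(y)) = q(a,b)/(q_A(a) q_B(b)), where x = e_X(a,c) and y = e_Y(b,d). -/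
open Finset

/-- The first marginal of a factorized joint pmf is `q_A(a) r(c)`. -/
theorem margX_eq_of_factorization {A B C D 𝒳 𝒴 : Type*}
    [Fintype B] [Fintype D] [Fintype 𝒴]
    (eX : A × C ≃ 𝒳) (eY : B × D ≃ 𝒴)
    {q : A × B → ℝ} {r : C → ℝ} {s : D → ℝ} (hs : ∑ d, s d = 1) {p : 𝒳 × 𝒴 → ℝ}
    (hp : ∀ a c b d, p (eX (a, c), eY (b, d)) = q (a, b) * r c * s d) (a : A) (c : C) :
    margX p (eX (a, c)) = (∑ b, q (a, b)) * r c := by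
  rw [margX, ← eY.sum_comp, Fintype.sum_prod_type]
  simp only [hp, ← Finset.mul_sum, hs, mul_one, ← Finset.sum_mul]

/-- The second marginal of a factorized joint pmf is `q_B(b) s(d)`. -/
theorem margY_eq_of_factorization {A B C D 𝒳 𝒴 : Type*}
    [Fintype A] [Fintype C] [Fintype 𝒳]
    (eX : A × C ≃ 𝒳) (eY : B × D ≃ 𝒴)
    {q : A × B → ℝ} {r : C → ℝ} {s : D → ℝ} (hr : ∑ c, r c = 1) {p : 𝒳 × 𝒴 → ℝ}
    (hp : ∀ a c b d, p (eX (a, c), eY (b, d)) = q (a, b) * r c * s d) (b : B) (d : D) :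
    margY p (eY (b, d)) = (∑ a, q (a, b)) * s d := by
  rw [margY, ← eX.sum_comp, Fintype.sum_prod_type]
  simp only [hp, ← Finset.mul_sum, hr, mul_one, ← Finset.sum_mul]

/-- **(Invariance of pointwise mutual information under the generation process.)** Let
`X = e_X(A × C)` and `Y = e_Y(B × D)` be bijective images of latent variables, where the
joint pmf factorizes as `p(e_X(a,c), e_Y(b,d)) = q(a,b) r(c) s(d)` — i.e. `(A,B)`, `C`,
`D` are mutually independent. Then, at every point of positive probability, the pointwise
mutual information of `p` equals that of the latent joint pmf `q`. -/
theorem pmi_invariant_under_generation_process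
    {A B C D 𝒳 𝒴 : Type*}
    [Fintype A] [Fintype B] [Fintype C] [Fintype D] [Fintype 𝒳] [Fintype 𝒴]
    [Nonempty A] [Nonempty B] [Nonempty C] [Nonempty D] [Nonempty 𝒳] [Nonempty 𝒴]
    (eX : A × C ≃ 𝒳) (eY : B × D ≃ 𝒴)
    (q : A × B → ℝ) (hq : IsPmf q)
    (r : C → ℝ) (hr : IsPmf r)
    (s : D → ℝ) (hs : IsPmf s)
    (p : 𝒳 × 𝒴 → ℝ)
    (hpdef : ∀ a c b d, p (eX (a, c), eY (b, d)) = q (a, b) * r c * s d) :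
    ∀ a b c d,
      0 < q (a, b) → 0 < ∑ b', q (a, b') → 0 < ∑ a', q (a', b) →
      0 < r c → 0 < s d →
      p (eX (a, c), eY (b, d)) / (margX p (eX (a, c)) * margY p (eY (b, d)))
        = q (a, b) / ((∑ b', q (a, b')) * ∑ a', q (a', b)) := by
  intro a b c d _ hA hB hc hd
  rw [hpdef, margX_eq_of_factorization eX eY hs.2 hpdef,
    margY_eq_of_factorization eX eY hr.2 hpdef]
  field_simp
end

section
/- Let (Ω, 𝔽, ℙ) be a probability space, let ω : Ω → ℝ^d be a random vector, and let β : Ω → ℝ be uniformly distributed on the interval [0, 2π], with ω and β independent. Let k : ℝ^d → ℝ be a function such that for every t ∈ ℝ^d, E[cos(⟪ω, t⟫)] = k(t). Then for all u, v ∈ ℝ^d, E[ 2 · cos(⟪ω, u⟫ + β) · cos(⟪ω, v⟫ + β) ] = k(u − v); that is, the random Fourier feature product is an unbiased estimator of the shift-invariant kernel. -/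
open MeasureTheory ProbabilityTheory Real
open scoped RealInnerProductSpace

/-- Adding twice an independent phase, uniform on `[0, 2π]`, makes the cosine centered. -/
theorem integral_cos_add_two_mul_eq_zero {Ω : Type*} [MeasurableSpace Ω] {μ : Measure Ω}
    [IsProbabilityMeasure μ] {X β : Ω → ℝ} (hX : Measurable X) (hβ : Measurable β)
    (hunif : Measure.map β μ
      = (ENNReal.ofReal (2 * Real.pi))⁻¹ • (volume.restrict (Set.Icc 0 (2 * Real.pi))))
    (hindep : IndepFun X β μ) :
    ∫ a, Real.cos (X a + 2 * β a) ∂μ = 0 := by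
  have hmap (f : ℝ → ℝ) (hf : Measurable f)
      (h : ∫ x in (0 : ℝ)..(2 * Real.pi), f x = 0) : ∫ a, f (β a) ∂μ = 0 := by
    rw [← integral_map hβ.aemeasurable hf.aestronglyMeasurable, hunif, integral_smul_measure,
      integral_Icc_eq_integral_Ioc, ← intervalIntegral.integral_of_le Real.two_pi_pos.le, h,
      smul_zero]
  have hcos : ∫ a, Real.cos (2 * β a) ∂μ = 0 := by
    refine hmap (fun x => Real.cos (2 * x)) (by fun_prop) ?_
    rw [intervalIntegral.integral_comp_mul_left Real.cos two_ne_zero, integral_cos]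
    have h : Real.sin (2 * (2 * Real.pi)) = 0 := by
      rw [Real.sin_two_mul, Real.sin_two_pi, mul_zero, zero_mul]
    simp [h]
  have hsin : ∫ a, Real.sin (2 * β a) ∂μ = 0 := by
    refine hmap (fun x => Real.sin (2 * x)) (by fun_prop) ?_
    rw [intervalIntegral.integral_comp_mul_left Real.sin two_ne_zero, integral_sin]
    have h : Real.cos (2 * (2 * Real.pi)) = 1 := by
      simpa using Real.cos_nat_mul_two_pi 2
    simp [h]
  simp_rw [Real.cos_add]
  rw [integral_sub,
    hindep.integral_fun_comp_mul_comp (f := Real.cos) (g := fun x => Real.cos (2 * x))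
      hX.aemeasurable hβ.aemeasurable (by fun_prop) (by fun_prop),
    hindep.integral_fun_comp_mul_comp (f := Real.sin) (g := fun x => Real.sin (2 * x))
      hX.aemeasurable hβ.aemeasurable (by fun_prop) (by fun_prop), hcos, hsin]
  · simp
  · refine Integrable.of_bound (by fun_prop) 1 (.of_forall fun a => ?_)
    rw [norm_mul]
    exact mul_le_one₀ (Real.abs_cos_le_one _) (norm_nonneg _) (Real.abs_cos_le_one _)
  · refine Integrable.of_bound (by fun_prop) 1 (.of_forall fun a => ?_)
    rw [norm_mul]
    exact mul_le_one₀ (Real.abs_sin_le_one _) (norm_nonneg _) (Real.abs_sin_le_one _)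

/-- **(Random Fourier features are unbiased estimators of a shift-invariant kernel.)** Let
`ω : Ω → ℝ^d` be a random vector and `β : Ω → ℝ` be uniform on `[0, 2π]`, with `ω` and
`β` independent. If `k : ℝ^d → ℝ` satisfies Bochner's representation
`E[cos ⟪ω, t⟫] = k t` for all `t`, then for all `u v : ℝ^d`,
`E[2 cos(⟪ω, u⟫ + β) cos(⟪ω, v⟫ + β)] = k (u − v)`. -/
theorem rff_unbiased
    {Ω : Type*} [MeasureSpace Ω] [IsProbabilityMeasure (ℙ : Measure Ω)]
    {d : ℕ} (ω : Ω → EuclideanSpace ℝ (Fin d)) (β : Ω → ℝ)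
    (hωm : Measurable ω) (hβm : Measurable β)
    (hβunif : Measure.map β ℙ
      = (ENNReal.ofReal (2 * Real.pi))⁻¹ • (volume.restrict (Set.Icc 0 (2 * Real.pi))))
    (hindep : IndepFun ω β ℙ)
    (k : EuclideanSpace ℝ (Fin d) → ℝ)
    (hk : ∀ t, ∫ a, Real.cos ⟪ω a, t⟫ ∂ℙ = k t) :
    ∀ u v : EuclideanSpace ℝ (Fin d),
      ∫ a, 2 * Real.cos (⟪ω a, u⟫ + β a) * Real.cos (⟪ω a, v⟫ + β a) ∂ℙ
        = k (u - v) := by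
  intro u v
  have hprod (a : Ω) :
      2 * Real.cos (⟪ω a, u⟫ + β a) * Real.cos (⟪ω a, v⟫ + β a)
        = Real.cos ⟪ω a, u - v⟫ + Real.cos (⟪ω a, u + v⟫ + 2 * β a) := by
    rw [Real.two_mul_cos_mul_cos, inner_sub_right, inner_add_right]
    ring_nf
  have hzero : ∫ a, Real.cos (⟪ω a, u + v⟫ + 2 * β a) ∂ℙ = 0 :=
    integral_cos_add_two_mul_eq_zero (by fun_prop) hβm hβunif
      (hindep.comp (φ := fun x => ⟪x, u + v⟫) (by fun_prop) measurable_id)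
  simp_rw [hprod]
  rw [integral_add, hk, hzero, add_zero]
  · exact Integrable.of_bound (by fun_prop) 1 (.of_forall fun a => Real.abs_cos_le_one _)
  · exact Integrable.of_bound (by fun_prop) 1 (.of_forall fun a => Real.abs_cos_le_one _)
end
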